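/- Let A = diag(λ_1,...,λ_n) with distinct λ_i ∈ [0,1) and b ∈ R^n with entries b_i. Then the volume of the infinite zonotope ∑_{k=0}^{∞} [-1,1]·A^k b equals 2^n · |∏_{1≤j_1<j_2≤n} (λ_{j_2}-λ_{j_1})/(1-λ_{j_1}λ_{j_2})| · ∏_{i=1}^n |b_i|/(1-λ_i). -/

import Mathlib

open MeasureTheory

lemma prod_erase_eq_ite {m : ℕ} (i : Fin m) (f : Fin m → ℝ) :
    ∏ k ∈ Finset.univ.erase i, f k = ∏ k, (if k = i then 1 else f k) := by
  rw [← Finset.mul_prod_erase Finset.univ _ (Finset.mem_univ i)]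
  simp only [if_true, one_mul]
  apply Finset.prod_congr rfl
  intro k hk
  rw [if_neg (Finset.ne_of_mem_erase hk)]

lemma lagrange_id (n : ℕ) (x : Fin (n+1) → ℝ) (hx : ∀ i, 0 ≤ x i ∧ x i < 1)
    (hinj : Function.Injective x) :
    ∑ j, (1 - x j) * ∏ m : Fin n, (x (j.succAbove m) * (1 - x j * x (j.succAbove m))
      / (x (j.succAbove m) - x j)) = 1 - ∏ i, x i := by
  by_cases h0 : ∃ i, x i = 0
  · obtain ⟨p, hp⟩ := h0
    rw [Finset.prod_eq_zero (Finset.mem_univ p) hp, Finset.sum_eq_single p]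
    · rw [hp, Finset.prod_eq_one]
      · simp
      · intro m _
        have : x (p.succAbove m) ≠ 0 := by
          rw [← hp]; exact fun h => Fin.succAbove_ne p m (hinj h)
        field_simp
        simp
    · intro j _ hj
      obtain ⟨m, hm⟩ := Fin.exists_succAbove_eq hj.symm
      rw [Finset.prod_eq_zero (Finset.mem_univ m), mul_zero]
      rw [hm, hp]; simp
    · simp
  · push Not at h0
    have hpos : ∀ i, 0 < x i := fun i => lt_of_le_of_ne (hx i).1 (h0 i).symm
    set v : Fin (n+1+1+1) → ℝ := Fin.cons 0 (Fin.cons (-1) x) with hv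
    have hvinj : Function.Injective v := by
      rw [hv, Fin.cons_injective_iff, Fin.cons_injective_iff]
      refine ⟨?_, ?_, hinj⟩
      · rintro ⟨i, hi⟩
        revert hi
        refine Fin.cases ?_ ?_ i
        · simp
        · intro k; simpa using h0 k
      · rintro ⟨i, hi⟩
        have := hpos i
        linarith
    set P : Polynomial ℝ := ∏ i, (1 - Polynomial.C (x i) * Polynomial.X) with hP
    have hd1 : ∀ i, (1 - Polynomial.C (x i) * Polynomial.X : Polynomial ℝ).natDegree ≤ 1 := by
      intro i
      compute_degree
    have hdeg : P.natDegree ≤ n + 1 := by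
      refine (Polynomial.natDegree_prod_le _ _).trans ?_
      refine (Finset.sum_le_sum (fun i _ => hd1 i)).trans ?_
      simp
    have key := Lagrange.coeff_eq_sum (s := Finset.univ) (v := v) hvinj.injOn (P := P) (by
      refine lt_of_le_of_lt Polynomial.degree_le_natDegree ?_
      simp only [Finset.card_univ, Fintype.card_fin]
      exact_mod_cast (by omega : P.natDegree < n+1+1+1))
    rw [Polynomial.coeff_eq_zero_of_natDegree_lt (by simp; omega)] at key
    simp only [prod_erase_eq_ite, Fin.sum_univ_succ (n := n+1+1), Fin.sum_univ_succ (n := n+1)] at key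
    simp only [Fin.prod_univ_succ (n := n+1+1), Fin.prod_univ_succ (n := n+1)] at key
    have hev : ∀ t, P.eval t = ∏ i, (1 - x i * t) := by
      intro t; rw [hP, Polynomial.eval_prod]; simp
    simp only [hev, hv, Fin.cons_zero, Fin.cons_succ, Fin.succ_inj, Fin.succ_ne_zero, if_true, if_false,
      (Fin.succ_ne_zero _).symm] at key
    have e1 : ∏ i, (1 - x i * -1) / (-1 - x i) = (-1)^(n+1) := by
      rw [← Fin.prod_const]
      apply Finset.prod_congr rfl
      intro i _
      have := hpos i
      rw [div_eq_iff (by linarith)]; ring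
    have e2 : ∏ i, (0 - x i) = (-1)^(n+1) * ∏ i, x i := by
      rw [← Fin.prod_const, ← Finset.prod_mul_distrib]
      apply Finset.prod_congr rfl
      intro i _; ring
    have hne : ∏ i, x i ≠ 0 := Finset.prod_ne_zero_iff.2 (fun i _ => h0 i)
    have e3 : ∀ j : Fin (n+1), (∏ i, (1 - x i * x j)) / ((x j - 0) * ((x j - -1) *
        ∏ k, if k = j then 1 else (x j - x k))) * ∏ i, x i = 
        (-1)^n * ((1 - x j) * ∏ m : Fin n, (x (j.succAbove m) * (1 - x j * x (j.succAbove m))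
      / (x (j.succAbove m) - x j))) := by
      intro j
      have hj := hpos j
      rw [Fin.prod_univ_succAbove _ j, Fin.prod_univ_succAbove (fun k => if k = j then (1:ℝ) else (x j - x k)) j,
        Fin.prod_univ_succAbove x j]
      simp only [if_true, Fin.succAbove_ne, if_false, one_mul, sub_zero]
      have : ∏ m : Fin n, (x j - x (j.succAbove m)) = (-1)^n * ∏ m : Fin n, (x (j.succAbove m) - x j) := by
        rw [← Fin.prod_const, ← Finset.prod_mul_distrib]
        apply Finset.prod_congr rfl
        intro i _; ring
      rw [this, Finset.prod_div_distrib, Finset.prod_mul_distrib]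
      have hne2 : ∏ m : Fin n, (x (j.succAbove m) - x j) ≠ 0 := 
        Finset.prod_ne_zero_iff.2 (fun m _ => sub_ne_zero.2 (fun h => Fin.succAbove_ne j m (hinj h)))
      have hsq : ((-1:ℝ)^n) * (-1)^n = 1 := by rw [← mul_pow]; simp
      have hc : ∏ i : Fin n, (1 - x (j.succAbove i) * x j) = ∏ i : Fin n, (1 - x j * x (j.succAbove i)) :=
        Finset.prod_congr rfl (fun i _ => by ring)
      rw [hc]
      have h1 : x j + 1 ≠ 0 := by linarith
      have h1n : ((-1:ℝ)^n) ≠ 0 := by positivity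
      rw [sub_neg_eq_add]
      field_simp
      rw [pow_two ((-1:ℝ)^n), hsq]
      ring
    have key2 := congrArg (· * (∏ i, x i)) key
    simp only [add_mul, Finset.sum_mul, e3, zero_mul] at key2
    rw [← Finset.mul_sum] at key2
    have e4 : (∏ i, (1 - x i * -1)) / ((-1 - 0) * (1 * ∏ k, (-1 - x k))) = (-1)^n := by
      rw [Finset.prod_div_distrib] at e1
      rw [one_mul, sub_zero, neg_one_mul, div_neg, e1]; ring
    have e5 : (∏ i, (1 - x i * 0)) / (1 * ((0 - -1) * ((-1) ^ (n + 1) * ∏ i, x i))) * ∏ i, x i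
        = (-1)^(n+1) := by
      have hsq : ((-1:ℝ)^(n+1)) * (-1)^(n+1) = 1 := by rw [← mul_pow]; simp
      have h1n : ((-1:ℝ)^(n+1)) ≠ 0 := by positivity
      simp only [mul_zero, sub_zero, Finset.prod_const_one, sub_neg_eq_add, zero_add, one_mul]
      rw [div_mul_eq_mul_div, div_eq_iff (mul_ne_zero h1n hne), ← mul_assoc, hsq]
    rw [e2, e4, e5] at key2
    have h1n : ((-1:ℝ)^n) ≠ 0 := by positivity
    apply mul_left_cancel₀ h1n
    rw [pow_succ] at key2
    linarith

/-- The closed form (without the factor `2^n` and `b`). -/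
noncomputable def closedP (n : ℕ) (x : Fin n → ℝ) : ℝ :=
  (∏ i : Fin n, ∏ j : Fin n, if i < j then (x j - x i) / (1 - x i * x j) else 1) *
    ∏ i : Fin n, (1 - x i)⁻¹

lemma prod_sign (n : ℕ) (p : Fin (n+1)) :
    ∏ m : Fin n, (if p < p.succAbove m then (1:ℝ) else -1) = (-1)^(p:ℕ) := by
  have : ∀ m : Fin n, (if p < p.succAbove m then (1:ℝ) else -1) = if (m:ℕ) < p then -1 else 1 := by
    intro m
    by_cases h : (m:ℕ) < p
    · have : ¬ p < p.succAbove m := by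
        rw [Fin.lt_succAbove_iff_le_castSucc, Fin.le_def]; simpa using h
      simp [h, this]
    · have : p < p.succAbove m := by
        rw [Fin.lt_succAbove_iff_le_castSucc, Fin.le_def]; simpa using h
      simp [h, this]
  simp only [this]
  rw [Finset.prod_ite]
  simp only [Finset.prod_const, one_pow, mul_one]
  congr 1
  have := p.is_lt
  rw [Fin.card_filter_val_lt]
  omega

lemma closedP_succAbove (n : ℕ) (x : Fin (n+1) → ℝ) (p : Fin (n+1)) :
    closedP (n+1) x = closedP n (x ∘ p.succAbove) * ((1 - x p)⁻¹ * ((-1)^(p:ℕ) *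
      ∏ m, ((x (p.succAbove m) - x p) / (1 - x p * x (p.succAbove m))))) := by
  unfold closedP
  rw [Fin.prod_univ_succAbove _ p, Fin.prod_univ_succAbove _ p, 
    Finset.prod_congr rfl (fun m _ => Fin.prod_univ_succAbove _ p), Finset.prod_mul_distrib,
    Fin.prod_univ_succAbove (fun i => (1 - x i)⁻¹) p, ← prod_sign]
  simp only [lt_irrefl, if_false, one_mul, Function.comp]
  have hc : (∏ m : Fin n, if p < p.succAbove m then (x (p.succAbove m) - x p) / (1 - x p * x (p.succAbove m)) else 1)
    * (∏ m : Fin n, if p.succAbove m < p then (x p - x (p.succAbove m)) / (1 - x (p.succAbove m) * x p) else 1)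
    = (∏ m : Fin n, (if p < p.succAbove m then (1:ℝ) else -1)) * ∏ m, ((x (p.succAbove m) - x p) / (1 - x p * x (p.succAbove m))) := by
    rw [← Finset.prod_mul_distrib, ← Finset.prod_mul_distrib]
    apply Finset.prod_congr rfl
    intro m _
    have hne := Fin.succAbove_ne p m
    rcases lt_or_gt_of_ne hne with h | h
    · rw [if_neg (not_lt.2 h.le), if_pos h, if_neg (not_lt.2 h.le), mul_comm (x (p.succAbove m)) (x p)]; ring
    · rw [if_neg (not_lt.2 h.le), if_pos h, if_pos h]; ring
  simp only [Fin.succAbove_lt_succAbove_iff]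
  rw [← hc]
  ring

lemma closedP_rec (n : ℕ) (x : Fin (n+1) → ℝ) (hx : ∀ i, 0 ≤ x i ∧ x i < 1)
    (hinj : Function.Injective x) :
    (1 - ∏ i, x i) * closedP (n+1) x = 
    ∑ j : Fin (n+1), (-1)^(j:ℕ) * ((∏ m, x (j.succAbove m)) * closedP n (x ∘ j.succAbove)) := by
  rw [← lagrange_id n x hx hinj, Finset.sum_mul]
  apply Finset.sum_congr rfl
  intro j _
  rw [closedP_succAbove n x j]
  have h1 : 1 - x j ≠ 0 := by linarith [(hx j).2]
  have hne : ∏ m : Fin n, (x (j.succAbove m) - x j) ≠ 0 := 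
        Finset.prod_ne_zero_iff.2 (fun m _ => sub_ne_zero.2 (fun h => Fin.succAbove_ne j m (hinj h)))
  have hne2 : ∏ m : Fin n, (1 - x j * x (j.succAbove m)) ≠ 0 := 
        Finset.prod_ne_zero_iff.2 (fun m _ => by
          have h1 := hx j
          have h2 := hx (j.succAbove m)
          nlinarith)
  rw [Finset.prod_div_distrib, Finset.prod_div_distrib, Finset.prod_mul_distrib]
  field_simp

/-- sum of `g k` over `0 ≤ k₀ < k₁ < ... < N`. -/
noncomputable def Sg : (n N : ℕ) → ((Fin n → ℕ) → ℝ) → ℝ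
  | 0, _, g => g Fin.elim0
  | _+1, 0, _ => 0
  | n+1, N+1, g => Sg (n+1) N (fun k => g (fun i => k i + 1)) +
      Sg n N (fun k => g (Fin.cons 0 (fun i => k i + 1)))

lemma Sg_congr (n N : ℕ) (g h : (Fin n → ℕ) → ℝ) (H : ∀ k, StrictMono k → g k = h k) :
    Sg n N g = Sg n N h := by
  induction N generalizing n with
  | zero => 
    cases n with
    | zero => exact H _ (fun i => i.elim0)
    | succ n => rfl
  | succ N ih =>
    cases n with
    | zero => exact H _ (fun i => i.elim0)
    | succ n => 
      simp only [Sg]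
      congr 1
      · apply ih
        intro k hk
        exact H _ (fun i j hij => Nat.succ_lt_succ (hk hij))
      · apply ih
        intro k hk
        apply H
        intro i j hij
        induction j using Fin.cases with
        | zero => exact absurd hij (Fin.not_lt_zero _)
        | succ j =>
          induction i using Fin.cases with
          | zero => simp
          | succ i => 
            simp only [Fin.cons_succ]
            exact Nat.succ_lt_succ (hk (Fin.succ_lt_succ_iff.1 hij))

lemma Sg_mul (n N : ℕ) (c : ℝ) (g : (Fin n → ℕ) → ℝ) :
    Sg n N (fun k => c * g k) = c * Sg n N g := by
  induction N generalizing n with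
  | zero => cases n <;> simp [Sg]
  | succ N ih => 
    cases n with
    | zero => simp [Sg]
    | succ n => simp only [Sg, ih, mul_add]

lemma Sg_sum {ι : Type*} (s : Finset ι) (n N : ℕ) (g : ι → (Fin n → ℕ) → ℝ) :
    Sg n N (fun k => ∑ i ∈ s, g i k) = ∑ i ∈ s, Sg n N (g i) := by
  induction N generalizing n with
  | zero => cases n <;> simp [Sg]
  | succ N ih => 
    cases n with
    | zero => simp [Sg]
    | succ n => simp only [Sg, ih, Finset.sum_add_distrib]

lemma Sg_nonneg (n N : ℕ) (g : (Fin n → ℕ) → ℝ) (H : ∀ k, 0 ≤ g k) :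
    0 ≤ Sg n N g := by
  induction N generalizing n with
  | zero => cases n <;> simp [Sg, H]
  | succ N ih => 
    cases n with
    | zero => simp [Sg, H]
    | succ n => 
      simp only [Sg]
      exact add_nonneg (ih _ _ (fun _ => H _)) (ih _ _ (fun _ => H _))

noncomputable def Dn (n N : ℕ) (x : Fin n → ℝ) : ℝ :=
  Sg n N (fun k => (Matrix.of (fun i j => x j ^ k i)).det)

lemma det_shift (n : ℕ) (x : Fin n → ℝ) (k : Fin n → ℕ) : 
    (Matrix.of (fun i j => x j ^ (k i + 1))).det = (∏ j, x j) * (Matrix.of (fun i j => x j ^ k i)).det := by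
  rw [← Matrix.det_mul_row]
  congr 1
  ext i j
  simp [pow_succ, mul_comm]

lemma Dn_rec (n N : ℕ) (x : Fin (n+1) → ℝ) :
    Dn (n+1) (N+1) x = (∏ i, x i) * Dn (n+1) N x + 
    ∑ j : Fin (n+1), (-1)^(j:ℕ) * ((∏ m, x (j.succAbove m)) * Dn n N (x ∘ j.succAbove)) := by
  simp only [Dn, Sg]
  congr 1
  · simp only [det_shift, Sg_mul]
  · simp only [← Sg_mul, ← Sg_sum]
    congr 1
    ext k
    rw [Matrix.det_succ_row_zero]
    apply Finset.sum_congr rfl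
    intro j _
    have h1 := det_shift n (x ∘ j.succAbove) k
    simp only [Function.comp_apply] at h1 ⊢
    rw [← h1]
    change (-1) ^ (j:ℕ) * (x j ^ 0) * _ = _
    rw [pow_zero, mul_one]
    rfl

lemma tendsto_rec (a c : ℕ → ℝ) (r C L : ℝ) (hr : 0 ≤ r) (hr1 : r < 1) 
    (h : ∀ N, a (N+1) = r * a N + c N) (hc : Filter.Tendsto c Filter.atTop (nhds C))
    (hL : (1 - r) * L = C) : Filter.Tendsto a Filter.atTop (nhds L) := by
  rw [Metric.tendsto_atTop] at hc ⊢
  intro ε hε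
  obtain ⟨M, hM⟩ := hc ((1 - r) * (ε/2)) (by have : 0 < 1 - r := by linarith
                                             positivity)
  have hb : ∀ m, |a (M + m) - L| ≤ r^m * |a M - L| + ε/2 := by
    intro m
    induction m with
    | zero => simp; positivity
    | succ m ih =>
      have h1 := hM (M+m) (by omega)
      rw [Real.dist_eq] at h1
      have h2 : a (M + (m+1)) - L = r * (a (M+m) - L) + (c (M+m) - C) := by
        rw [← hL, ← add_assoc, h]; ring
      rw [h2]
      refine (abs_add_le _ _).trans ?_
      rw [abs_mul, abs_of_nonneg hr, pow_succ]
      nlinarith [mul_le_mul_of_nonneg_left ih hr]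
  have ht : Filter.Tendsto (fun m => r^m * |a M - L|) Filter.atTop (nhds 0) := by
    simpa using (tendsto_pow_atTop_nhds_zero_of_lt_one hr hr1).mul_const (|a M - L|)
  obtain ⟨K, hK⟩ := (Metric.tendsto_atTop.1 ht) (ε/2) (by positivity)
  refine ⟨M + K, fun m hm => ?_⟩
  obtain ⟨d, rfl⟩ := Nat.exists_eq_add_of_le (show M ≤ m by omega)
  have h1 := hK d (by omega)
  rw [Real.dist_eq, sub_zero] at h1
  rw [Real.dist_eq]
  have := (abs_lt.1 h1).2
  linarith [hb d]

lemma Dn_tendsto (n : ℕ) (x : Fin n → ℝ) (hx : ∀ i, 0 ≤ x i ∧ x i < 1)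
    (hinj : Function.Injective x) :
    Filter.Tendsto (fun N => Dn n N x) Filter.atTop (nhds (closedP n x)) := by
  induction n with
  | zero => simp [Dn, Sg, closedP]
  | succ n ih =>
    apply tendsto_rec _ _ (∏ i, x i) _ _ (Finset.prod_nonneg (fun i _ => (hx i).1)) ?_
      (fun N => Dn_rec n N x) ?_ (closedP_rec n x hx hinj)
    · rw [Fin.prod_univ_succ]
      have : ∏ i : Fin n, x i.succ ≤ 1 := Finset.prod_le_one (fun i _ => (hx _).1) (fun i _ => (hx _).2.le)
      nlinarith [hx 0]
    · apply tendsto_finsetSum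
      intro j _
      exact ((ih _ (fun i => hx _) (hinj.comp Fin.succAbove_right_injective)).const_mul _).const_mul _

lemma det_diff_nonneg (n : ℕ) (F F' : Fin n → ℝ → ℝ) (hF : ∀ j t, HasDerivAt (F j) (F' j t) t)
    (x : Fin (n+1) → ℝ) (hx : Monotone x)
    (H : ∀ t : Fin n → ℝ, (∀ i, t i ∈ Set.Icc (x i.castSucc) (x i.succ)) →
      0 ≤ (Matrix.of (fun i j => F' j (t i))).det) :
    0 ≤ (Matrix.of (fun i j : Fin n => F j (x i.succ) - F j (x i.castSucc))).det := by
  have key : ∀ s : ℕ, s ≤ n → ∀ t : Fin n → ℝ, (∀ i, t i ∈ Set.Icc (x i.castSucc) (x i.succ)) →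
      0 ≤ (Matrix.of (fun i j : Fin n => if (i:ℕ) < s then F j (x i.succ) - F j (x i.castSucc)
        else F' j (t i))).det := by
    intro s
    induction s with
    | zero => intro _ t ht; simpa using H t ht
    | succ s ih =>
      intro hs t ht
      set p : Fin n := ⟨s, hs⟩ with hp
      set M : Matrix (Fin n) (Fin n) ℝ := Matrix.of (fun i j : Fin n => if (i:ℕ) < s + 1 then 
        F j (x i.succ) - F j (x i.castSucc) else F' j (t i)) with hM
      let l : (Fin n → ℝ) →ₗ[ℝ] ℝ := (LinearMap.proj p).comp (Matrix.cramer M.transpose)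
      have hl : ∀ r, l r = (M.updateRow p r).det := fun r => Matrix.cramer_transpose_apply M r p
      have hder : ∀ τ, HasDerivAt (fun τ => l (fun j => F j τ)) (l (fun j => F' j τ)) τ := by
        intro τ
        have h1 : HasDerivAt (fun τ => (fun j => F j τ)) (fun j => F' j τ) τ :=
          hasDerivAt_pi.2 (fun j => hF j τ)
        exact (l.toContinuousLinearMap.hasFDerivAt (x := fun j => F j τ)).comp_hasDerivAt τ h1
      have hnn : ∀ τ ∈ Set.Icc (x p.castSucc) (x p.succ), 0 ≤ l (fun j => F' j τ) := by
        intro τ hτ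
        rw [hl]
        have := ih (by omega) (Function.update t p τ) (by
          intro i
          by_cases hi : i = p
          · subst hi; simpa using hτ
          · simpa [hi] using ht i)
        convert this using 2
        ext i j
        by_cases hi : i = p
        · subst hi; simp [hp]
        · have h2 : (i:ℕ) ≠ s := fun h => hi (Fin.ext h)
          have h3 : (i:ℕ) ≤ s ↔ (i:ℕ) < s := by omega
          simp [hi, hM, h3]
      have hmono : MonotoneOn (fun τ => l (fun j => F j τ)) (Set.Icc (x p.castSucc) (x p.succ)) := by
        apply monotoneOn_of_deriv_nonneg (convex_Icc _ _)
        · exact fun τ _ => (hder τ).continuousAt.continuousWithinAt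
        · exact fun τ _ => (hder τ).differentiableAt.differentiableWithinAt
        · intro τ hτ
          rw [(hder τ).deriv]
          exact hnn τ (interior_subset hτ)
      have hle : x p.castSucc ≤ x p.succ := hx (Fin.castSucc_lt_succ).le
      have h4 := hmono (Set.left_mem_Icc.2 hle) (Set.right_mem_Icc.2 hle) hle
      have h5 : M.det = l (fun j => F j (x p.succ)) - l (fun j => F j (x p.castSucc)) := by
        rw [← map_sub, hl]
        congr 1
        ext i j
        by_cases hi : i = p
        · subst hi; simp [hM, hp]
        · simp [hi]
      rw [h5]
      simpa using h4
  have := key n le_rfl (fun i => x i.castSucc) (fun i => ⟨le_rfl, hx (Fin.castSucc_lt_succ).le⟩)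
  simpa using this

lemma genVand_nonneg (n : ℕ) (x : Fin n → ℝ) (hx : Monotone x) (h0 : ∀ i, 0 ≤ x i)
    (k : Fin n → ℕ) (hk : StrictMono k) : 0 ≤ (Matrix.of (fun i j => x i ^ k j)).det := by
  induction n with
  | zero => simp
  | succ n ih =>
    set m : Fin n → ℕ := fun j => k j.succ - k 0 with hm
    have hlt : ∀ j : Fin n, k 0 < k j.succ := fun j => hk (Fin.succ_pos j)
    have e1 : (Matrix.of (fun i j => x i ^ k j)).det = (∏ i, x i ^ k 0) * 
        (Matrix.of (fun i j => x i ^ (k j - k 0))).det := by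
      rw [← Matrix.det_mul_column]
      congr 1
      ext i j
      simp only [Matrix.of_apply]
      rw [← pow_add]
      congr 1
      have : k 0 ≤ k j := hk.monotone (Fin.zero_le j)
      omega
    have e2 : (Matrix.of (fun i j => x i ^ (k j - k 0))).det = 
        (Matrix.of (fun i j : Fin (n+1) => Fin.cases (motive := fun _ => ℝ) (x 0 ^ (k j - k 0)) 
          (fun i : Fin n => x i.succ ^ (k j - k 0) - x i.castSucc ^ (k j - k 0)) i)).det := by
      apply Matrix.det_eq_of_forall_row_eq_smul_add_pred (fun _ => 1)
      · intro j; simp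
      · intro i j; simp
    have e3 : (Matrix.of (fun i j : Fin (n+1) => Fin.cases (motive := fun _ => ℝ) (x 0 ^ (k j - k 0)) 
          (fun i : Fin n => x i.succ ^ (k j - k 0) - x i.castSucc ^ (k j - k 0)) i)).det =
        (Matrix.of (fun i j : Fin n => x i.succ ^ m j - x i.castSucc ^ m j)).det := by
      rw [Matrix.det_succ_column_zero, Fin.sum_univ_succ]
      simp
      rfl
    rw [e1, e2, e3]
    apply mul_nonneg (Finset.prod_nonneg (fun i _ => pow_nonneg (h0 i) _))
    apply det_diff_nonneg n (fun j t => t ^ m j) (fun j t => m j * t ^ (m j - 1)) 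
      (fun j t => hasDerivAt_pow _ _) x hx
    intro t ht
    have e4 : (Matrix.of (fun i j => (m j : ℝ) * t i ^ (m j - 1))).det = (∏ j, (m j : ℝ)) *
        (Matrix.of (fun i j => t i ^ (m j - 1))).det := by
      rw [← Matrix.det_mul_row]
      rfl
    rw [e4]
    apply mul_nonneg (Finset.prod_nonneg (fun i _ => Nat.cast_nonneg _))
    apply ih
    · intro i j hij
      rcases hij.eq_or_lt with h | h
      · rw [h]
      · refine (ht i).2.trans (le_trans (hx ?_) (ht j).1)
        rw [Fin.le_def]; simpa using h
    · intro i; exact (h0 _).trans (ht i).1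
    · intro i j hij
      have h1 := hk (Fin.succ_lt_succ_iff.2 hij)
      have h2 := hlt i
      simp only [hm]
      omega

lemma det_sign (n : ℕ) (x : Fin n → ℝ) (h0 : ∀ i, 0 ≤ x i) :
    ∃ ε : ℝ, |ε| = 1 ∧ ∀ k : Fin n → ℕ, StrictMono k →
      |(Matrix.of (fun i j => x j ^ k i)).det| = ε * (Matrix.of (fun i j => x j ^ k i)).det := by
  refine ⟨((Equiv.Perm.sign (Tuple.sort x) : ℤ) : ℝ), ?_, ?_⟩
  · rcases Int.units_eq_one_or (Equiv.Perm.sign (Tuple.sort x)) with h | h <;> simp [h]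
  · intro k hk
    have h1 := genVand_nonneg n (x ∘ Tuple.sort x) (Tuple.monotone_sort x) (fun i => h0 _) k hk
    have h2 : (Matrix.of (fun i j => (x ∘ Tuple.sort x) i ^ k j)).det = 
        ((Equiv.Perm.sign (Tuple.sort x) : ℤ) : ℝ) * (Matrix.of (fun i j => x j ^ k i)).det := by
      rw [← Matrix.det_permute', ← Matrix.det_transpose]
      rfl
    rw [← h2, ← abs_of_nonneg h1, h2, abs_mul]
    rcases Int.units_eq_one_or (Equiv.Perm.sign (Tuple.sort x)) with h | h <;> simp [h]

/-- Zonotope generated by `v 0, ..., v (N-1)`. -/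
def Zn (n : ℕ) : (N : ℕ) → (ℕ → Fin n → ℝ) → Set (Fin n → ℝ)
  | 0, _ => {0}
  | N+1, v => (fun p : (Fin n → ℝ) × ℝ => p.1 + p.2 • v 0) ''
      (Zn n N (fun k => v (k+1)) ×ˢ Set.Icc (-1) 1)

lemma Zn_compact (n N : ℕ) (v : ℕ → Fin n → ℝ) : IsCompact (Zn n N v) := by
  induction N generalizing v with
  | zero => exact isCompact_singleton
  | succ N ih => exact ((ih _).prod isCompact_Icc).image (by fun_prop)

lemma Zn_convex (n N : ℕ) (v : ℕ → Fin n → ℝ) : Convex ℝ (Zn n N v) := by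
  induction N generalizing v with
  | zero => exact convex_singleton _
  | succ N ih =>
    refine ((ih _).prod (convex_Icc _ _)).is_linear_image ⟨?_, ?_⟩
    · intro p q; simp only [Prod.fst_add, Prod.snd_add, add_smul]; abel
    · intro c p; simp only [Prod.smul_fst, Prod.smul_snd, smul_add, smul_assoc]

lemma Zn_nonempty (n N : ℕ) (v : ℕ → Fin n → ℝ) : (Zn n N v).Nonempty := by
  induction N generalizing v with
  | zero => exact Set.singleton_nonempty _
  | succ N ih => exact ((ih _).prod ⟨0, by simp⟩).image _

lemma Zn_map (n m N : ℕ) (v : ℕ → Fin n → ℝ) (L : (Fin n → ℝ) →ₗ[ℝ] (Fin m → ℝ)) :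
    Zn m N (fun k => L (v k)) = L '' (Zn n N v) := by
  induction N generalizing v with
  | zero => simp [Zn]
  | succ N ih =>
    simp only [Zn, ih (fun k => v (k+1))]
    ext x
    constructor
    · rintro ⟨⟨a, u⟩, ⟨⟨y, hy, rfl⟩, hu⟩, rfl⟩
      exact ⟨y + u • v 0, ⟨(y, u), ⟨hy, hu⟩, rfl⟩, by simp⟩
    · rintro ⟨_, ⟨⟨y, u⟩, ⟨hy, hu⟩, rfl⟩, rfl⟩
      exact ⟨(L y, u), ⟨⟨y, hy, rfl⟩, hu⟩, by simp⟩

lemma Zn_mem (n N : ℕ) (v : ℕ → Fin n → ℝ) (x : Fin n → ℝ) :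
    x ∈ Zn n N v ↔ ∃ u : ℕ → ℝ, (∀ k, |u k| ≤ 1) ∧ x = ∑ k ∈ Finset.range N, u k • v k := by
  induction N generalizing v x with
  | zero => 
    simp only [Zn, Set.mem_singleton_iff, Finset.range_zero, Finset.sum_empty]
    exact ⟨fun h => ⟨0, by simp, h⟩, fun ⟨_, _, h⟩ => h⟩
  | succ N ih =>
    simp only [Zn, Finset.sum_range_succ']
    constructor
    · rintro ⟨⟨y, t⟩, ⟨hy, ht⟩, rfl⟩
      obtain ⟨u, hu, rfl⟩ := (ih _ _).1 hy
      refine ⟨fun k => Nat.casesOn k t u, ?_, rfl⟩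
      intro k
      cases k with
      | zero => exact abs_le.2 ht
      | succ k => exact hu k
    · rintro ⟨u, hu, rfl⟩
      exact ⟨(∑ k ∈ Finset.range N, u (k+1) • v (k+1), u 0), 
        ⟨(ih _ _).2 ⟨fun k => u (k+1), fun k => hu _, rfl⟩, abs_le.1 (hu 0)⟩, rfl⟩

lemma thicken_one (S : Set ℝ) (hc : IsCompact S) (hv : Convex ℝ S) (hn : S.Nonempty) :
    volume {t | ∃ s ∈ S, ∃ u ∈ Set.Icc (-1:ℝ) 1, t = s + u} = volume S + 2 := by
  have hS := eq_Icc_of_connected_compact ⟨hn, hv.isPreconnected⟩ hc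
  set a := sInf S
  set b := sSup S
  have hab : a ≤ b := by
    rw [hS] at hn; exact Set.nonempty_Icc.1 hn
  have : {t | ∃ s ∈ S, ∃ u ∈ Set.Icc (-1:ℝ) 1, t = s + u} = Set.Icc (a-1) (b+1) := by
    rw [hS]
    ext t
    constructor
    · rintro ⟨s, hs, u, hu, rfl⟩
      exact ⟨by linarith [hs.1, hu.1], by linarith [hs.2, hu.2]⟩
    · rintro ⟨h1, h2⟩
      refine ⟨max a (min b t), ⟨le_max_left _ _, max_le hab (min_le_left _ _)⟩, t - max a (min b t), ?_, by ring⟩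
      rcases le_total t a with h | h
      · rw [min_eq_right (h.trans hab), max_eq_left h]
        constructor <;> linarith
      · rcases le_total t b with h' | h'
        · rw [min_eq_right h', max_eq_right h]; simp
        · rw [min_eq_left h', max_eq_right hab]
          constructor <;> linarith
  rw [this, hS, Real.volume_Icc, Real.volume_Icc, show (2:ENNReal) = ENNReal.ofReal 2 by simp,
    ← ENNReal.ofReal_add (by linarith) (by norm_num)]
  congr 1; ring

lemma slice_eq (n : ℕ) (K : Set (Fin (n+1) → ℝ)) (y : Fin n → ℝ) :
    {t : ℝ | (Fin.cons t y : Fin (n+1) → ℝ) ∈ K} = (fun t : ℝ => (t, y)) ⁻¹'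
      ((MeasurableEquiv.piFinSuccAbove (fun _ : Fin (n+1) => ℝ) 0).symm ⁻¹' K) := by
  ext t
  have : (MeasurableEquiv.piFinSuccAbove (fun _ : Fin (n+1) => ℝ) 0).symm (t, y) =
      (Fin.cons t y : Fin (n+1) → ℝ) := by
    change (Fin.insertNth 0 t y : Fin (n+1) → ℝ) = _
    rw [Fin.insertNth_zero']
  change _ ↔ (MeasurableEquiv.piFinSuccAbove (fun _ : Fin (n+1) => ℝ) 0).symm (t, y) ∈ K
  rw [this]
  rfl

lemma volume_slices (n : ℕ) (K : Set (Fin (n+1) → ℝ)) (hK : IsCompact K) :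
    volume K = ∫⁻ y : Fin n → ℝ, volume {t : ℝ | Fin.cons t y ∈ K} := by
  have hp := (volume_preserving_piFinSuccAbove (fun _ : Fin (n+1) => ℝ) 0).symm
  have hm := hK.isClosed.measurableSet
  rw [← hp.measure_preimage hm.nullMeasurableSet]
  simp only [slice_eq]
  exact Measure.prod_apply_symm (hp.measurable hm)

lemma measurable_slices (n : ℕ) (K : Set (Fin (n+1) → ℝ)) (hK : IsCompact K) :
    Measurable (fun y : Fin n → ℝ => volume {t : ℝ | Fin.cons t y ∈ K}) := by
  have hp := (volume_preserving_piFinSuccAbove (fun _ : Fin (n+1) => ℝ) 0).symm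
  have hm := hK.isClosed.measurableSet
  simp only [slice_eq]
  exact measurable_measure_prodMk_right (μ := (volume : Measure ℝ)) (hp.measurable hm)

lemma thicken (n : ℕ) (K : Set (Fin (n+1) → ℝ)) (hc : IsCompact K) (hv : Convex ℝ K) :
    volume ((fun p : (Fin (n+1) → ℝ) × ℝ => p.1 + p.2 • (Fin.cons 1 0 : Fin (n+1) → ℝ)) ''
      (K ×ˢ Set.Icc (-1) 1)) = volume K + 2 * volume (Fin.tail '' K : Set (Fin n → ℝ)) := by
  have hT : IsCompact (Fin.tail '' K : Set (Fin n → ℝ)) := by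
    apply hc.image
    unfold Fin.tail
    fun_prop
  rw [volume_slices _ _ ((hc.prod isCompact_Icc).image (by fun_prop)), volume_slices _ _ hc,
    ← lintegral_indicator_const hT.isClosed.measurableSet, ← lintegral_add_left (measurable_slices _ _ hc)]
  congr 1
  ext y
  have hset : {t : ℝ | (Fin.cons t y : Fin (n+1) → ℝ) ∈ (fun p : (Fin (n+1) → ℝ) × ℝ => p.1 + p.2 • (Fin.cons 1 0 : Fin (n+1) → ℝ)) ''
      (K ×ˢ Set.Icc (-1) 1)} = {t | ∃ s ∈ {t : ℝ | (Fin.cons t y : Fin (n+1) → ℝ) ∈ K}, ∃ u ∈ Set.Icc (-1:ℝ) 1, t = s + u} := by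
    ext t
    constructor
    · rintro ⟨⟨z, u⟩, ⟨hz, hu⟩, h⟩
      refine ⟨z 0, ?_, u, hu, ?_⟩
      · have : (Fin.cons (z 0) y : Fin (n+1) → ℝ) = z := by
          ext i
          refine Fin.cases rfl (fun i => ?_) i
          have := congrFun h i.succ
          simpa using this.symm
        simpa [this] using hz
      · have := congrFun h 0
        simpa using this.symm
    · rintro ⟨s, hs, u, hu, rfl⟩
      refine ⟨(Fin.cons s y, u), ⟨hs, hu⟩, ?_⟩
      ext i
      refine Fin.cases ?_ (fun i => ?_) i <;> simp
  rw [hset]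
  by_cases hy : y ∈ (Fin.tail '' K : Set (Fin n → ℝ))
  · rw [Set.indicator_of_mem hy]
    apply thicken_one
    · have hcl : Topology.IsClosedEmbedding (fun t : ℝ => (Fin.cons t y : Fin (n+1) → ℝ)) := by
        apply Topology.IsClosedEmbedding.of_continuous_injective_isClosedMap
        · apply continuous_pi
          intro i
          refine Fin.cases ?_ (fun i => ?_) i
          · simpa using continuous_id'
          · simpa using continuous_const
        · intro a b h
          simpa using congrFun h 0
        · have hli : Function.LeftInverse (fun z : Fin (n+1) → ℝ => z 0) (fun t : ℝ => (Fin.cons t y : Fin (n+1) → ℝ)) := fun t => rfl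
          exact (hli.isClosedEmbedding (by fun_prop) (by
            apply continuous_pi
            intro i
            refine Fin.cases ?_ (fun i => ?_) i
            · simpa using continuous_id'
            · simpa using continuous_const)).isClosedMap
      exact hcl.isCompact_preimage hc
    · intro s hs t ht a b ha hb hab
      have := hv hs ht ha hb hab
      simp only [Set.mem_ofPred_eq]
      convert this using 1
      ext i
      refine Fin.cases ?_ (fun i => ?_) i
      · simp
      · simp [← add_mul, hab]
    · obtain ⟨z, hz, rfl⟩ := hy
      exact ⟨z 0, by simpa [Fin.cons_self_tail] using hz⟩
  · rw [Set.indicator_of_notMem hy]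
    have : {t : ℝ | (Fin.cons t y : Fin (n+1) → ℝ) ∈ K} = ∅ := by
      ext t
      simp only [Set.mem_ofPred_eq, Set.mem_empty_iff_false, iff_false]
      intro h
      exact hy ⟨_, h, rfl⟩
    have h2 : ∀ t : ℝ, (Fin.cons t y : Fin (n+1) → ℝ) ∉ K := fun t h => hy ⟨_, h, rfl⟩
    simp [h2]

noncomputable def Sabs (n N : ℕ) (v : ℕ → Fin n → ℝ) : ℝ :=
  Sg n N (fun k => |(Matrix.of (fun i j => v (k i) j)).det|)

lemma Sabs_nonneg (n N : ℕ) (v : ℕ → Fin n → ℝ) : 0 ≤ Sabs n N v :=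
  Sg_nonneg _ _ _ (fun _ => abs_nonneg _)

lemma Sabs_map (n N : ℕ) (v : ℕ → Fin n → ℝ) (L : (Fin n → ℝ) →ₗ[ℝ] (Fin n → ℝ)) :
    Sabs n N (fun k => L (v k)) = |LinearMap.det L| * Sabs n N v := by
  unfold Sabs
  rw [← Sg_mul]
  congr 1
  ext k
  rw [← LinearMap.det_toMatrix', ← abs_mul, ← Matrix.det_transpose (LinearMap.toMatrix' L), mul_comm, ← Matrix.det_mul]
  congr 2
  ext i j
  have := congrFun (LinearMap.toMatrix'_mulVec L (v (k i))) j
  simp only [Matrix.of_apply, Matrix.mul_apply, Matrix.transpose_apply]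
  rw [← this]
  simp [Matrix.mulVec, dotProduct, mul_comm]

lemma zonotope_volume (n N : ℕ) (v : ℕ → Fin n → ℝ) :
    volume (Zn n N v) = ENNReal.ofReal (2^n * Sabs n N v) := by
  induction N generalizing n v with
  | zero =>
    cases n with
    | zero => 
      have : Zn 0 0 v = Set.univ := Set.eq_univ_of_forall (fun x => Subsingleton.elim _ _)
      rw [this]; simp [Sabs, Sg, volume_pi]
    | succ n => simp [Zn, Sabs, Sg]
  | succ N ih =>
    cases n with
    | zero => 
      have : Zn 0 (N+1) v = Set.univ := by
        obtain ⟨y, hy⟩ := Zn_nonempty 0 (N+1) v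
        exact Set.eq_univ_of_forall (fun x => by rwa [Subsingleton.elim x y])
      rw [this]; simp [Sabs, Sg, volume_pi]
    | succ n =>
      have std : ∀ w : ℕ → Fin (n+1) → ℝ, w 0 = Fin.cons 1 0 → 
          volume (Zn (n+1) (N+1) w) = ENNReal.ofReal (2^(n+1) * Sabs (n+1) (N+1) w) := by
        intro w hw
        have htail : (Fin.tail '' (Zn (n+1) N (fun k => w (k+1))) : Set (Fin n → ℝ)) = 
            Zn n N (fun k => Fin.tail (w (k+1))) := 
          (Zn_map (n+1) n N (fun k => w (k+1)) (LinearMap.funLeft ℝ ℝ Fin.succ)).symm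
        have hS : Sabs (n+1) (N+1) w = Sabs (n+1) N (fun k => w (k+1)) + 
            Sabs n N (fun k => Fin.tail (w (k+1))) := by
          simp only [Sabs, Sg]
          congr 2
          ext k
          rw [Matrix.det_succ_row_zero, Fin.sum_univ_succ]
          simp [hw]
          rfl
        simp only [Zn]
        rw [hw, thicken _ _ (Zn_compact _ _ _) (Zn_convex _ _ _), htail, ih, ih, hS,
          show (2:ENNReal) = ENNReal.ofReal 2 by simp, ← ENNReal.ofReal_mul (by norm_num),
          ← ENNReal.ofReal_add (mul_nonneg (by positivity) (Sabs_nonneg _ _ _)) 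
            (mul_nonneg (by positivity) (mul_nonneg (by positivity) (Sabs_nonneg _ _ _)))]
        congr 1; ring
      by_cases h0 : v 0 = 0
      · have h1 : Zn (n+1) (N+1) v = Zn (n+1) N (fun k => v (k+1)) := by
          simp only [Zn, h0, smul_zero, add_zero]
          ext x
          constructor
          · rintro ⟨⟨y, u⟩, ⟨hy, hu⟩, rfl⟩; exact hy
          · intro hx; exact ⟨(x, 0), ⟨hx, by simp⟩, rfl⟩
        have h2 : Sabs (n+1) (N+1) v = Sabs (n+1) N (fun k => v (k+1)) := by
          simp only [Sabs, Sg]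
          rw [add_eq_left, Sg_congr n N _ (fun k => 0 * 0), Sg_mul, zero_mul]
          intro k _
          rw [Matrix.det_eq_zero_of_row_eq_zero 0]
          · simp
          · intro j; simp [h0]
        rw [h1, ih, h2]
      · have he : (Fin.cons 1 0 : Fin (n+1) → ℝ) ≠ 0 := fun h => by
          simpa using congrFun h 0
        obtain ⟨A, hA⟩ := SeparatingDual.exists_continuousLinearEquiv_apply_eq (R := ℝ) h0 he
        let L : (Fin (n+1) → ℝ) →ₗ[ℝ] (Fin (n+1) → ℝ) := A.symm.toLinearEquiv.toLinearMap
        have hv : v = fun k => L (A (v k)) := by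
          ext k; simp [L]
        rw [hv, Zn_map _ _ _ (fun k => A (v k)) L, Measure.addHaar_image_linearMap, Sabs_map _ _ (fun k => A (v k)) L,
          std (fun k => A (v k)) hA, ← ENNReal.ofReal_mul (abs_nonneg _)]
        congr 1; ring

theorem stmt7 (n : ℕ) (lam : Fin n → ℝ)
    (hlam : ∀ i, 0 ≤ lam i ∧ lam i < 1) (hdist : Function.Injective lam)
    (b : Fin n → ℝ)
    (A : Matrix (Fin n) (Fin n) ℝ) (hA : A = Matrix.diagonal lam) :
    volume {x : Fin n → ℝ | ∃ u : ℕ → ℝ, (∀ k, |u k| ≤ 1) ∧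
        HasSum (fun k : ℕ => u k • (A ^ k).mulVec b) x} =
    ENNReal.ofReal ((2 : ℝ) ^ n *
      |∏ i : Fin n, ∏ j : Fin n,
        if i < j then (lam j - lam i) / (1 - lam i * lam j) else 1| *
      ∏ i : Fin n, |b i| / (1 - lam i)) := by
  set v : ℕ → Fin n → ℝ := fun k => (A ^ k).mulVec b with hv
  have hvk : ∀ k j, v k j = b j * lam j ^ k := by
    intro k j
    simp [hv, hA, Matrix.diagonal_pow, Matrix.mulVec_diagonal, mul_comm]
  set U : Set (Fin n → ℝ) := ⋃ N, Zn n N v with hU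
  have hmono : Monotone (fun N => Zn n N v) := by
    intro N M hNM x hx
    obtain ⟨u, hu, rfl⟩ := (Zn_mem _ _ _ _).1 hx
    refine (Zn_mem _ _ _ _).2 ⟨fun k => if k < N then u k else 0, ?_, ?_⟩
    · intro k; dsimp only; split_ifs
      · exact hu k
      · simp
    · rw [← Finset.sum_subset (Finset.range_subset_range.2 hNM)]
      · apply Finset.sum_congr rfl
        intro k hk
        dsimp only
        rw [if_pos (Finset.mem_range.1 hk)]
      · intro k _ hk
        dsimp only
        rw [if_neg (by simpa using hk), zero_smul]
  have hconv : Convex ℝ U := hmono.directed_le.convex_iUnion (fun N => Zn_convex n N v)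
  have hUR : U ⊆ {x : Fin n → ℝ | ∃ u : ℕ → ℝ, (∀ k, |u k| ≤ 1) ∧
        HasSum (fun k : ℕ => u k • v k) x} := by
    intro x hx
    obtain ⟨N, hN⟩ := Set.mem_iUnion.1 hx
    obtain ⟨u, hu, rfl⟩ := (Zn_mem _ _ _ _).1 hN
    refine ⟨fun k => if k < N then u k else 0, ?_, ?_⟩
    · intro k; dsimp only; split_ifs
      · exact hu k
      · simp
    · have := hasSum_sum_of_ne_finset_zero (L := SummationFilter.unconditional ℕ) (f := fun k => (if k < N then u k else 0) • v k)
        (s := Finset.range N) (fun k hk => by rw [if_neg (by simpa using hk), zero_smul])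
      convert this using 1
      apply Finset.sum_congr rfl
      intro k hk
      rw [if_pos (Finset.mem_range.1 hk)]
  have hRU : {x : Fin n → ℝ | ∃ u : ℕ → ℝ, (∀ k, |u k| ≤ 1) ∧
        HasSum (fun k : ℕ => u k • v k) x} ⊆ closure U := by
    rintro x ⟨u, hu, hs⟩
    refine mem_closure_of_tendsto hs.tendsto_sum_nat (Filter.Eventually.of_forall (fun N => ?_))
    exact Set.mem_iUnion.2 ⟨N, (Zn_mem _ _ _ _).2 ⟨u, hu, rfl⟩⟩
  have hcl : volume (closure U) ≤ volume U := by
    rw [closure_eq_self_union_frontier]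
    refine (measure_union_le _ _).trans ?_
    rw [hconv.addHaar_frontier volume, add_zero]
  have hvol : volume {x : Fin n → ℝ | ∃ u : ℕ → ℝ, (∀ k, |u k| ≤ 1) ∧
        HasSum (fun k : ℕ => u k • v k) x} = volume U :=
    le_antisymm ((measure_mono hRU).trans hcl) (measure_mono hUR)
  rw [hvol]
  have ht := tendsto_measure_iUnion_atTop (μ := volume) hmono
  refine tendsto_nhds_unique ht ?_
  simp only [Function.comp_def, zonotope_volume]
  apply ENNReal.tendsto_ofReal
  obtain ⟨ε, hε, hdet⟩ := det_sign n lam (fun i => (hlam i).1)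
  have hS : ∀ N, Sabs n N v = (∏ i, |b i|) * (ε * Dn n N lam) := by
    intro N
    simp only [Sabs, Dn, ← Sg_mul]
    apply Sg_congr
    intro k hk
    rw [← hdet k hk, ← Finset.abs_prod, ← abs_mul, ← Matrix.det_mul_row]
    simp only [hvk]
    rfl
  have hlim := ((Dn_tendsto n lam hlam hdist).const_mul ε).const_mul (∏ i, |b i|)
  have hpos : 0 ≤ ε * closedP n lam := by
    refine ge_of_tendsto' ((Dn_tendsto n lam hlam hdist).const_mul ε) (fun N => ?_)
    rw [Dn, ← Sg_mul, Sg_congr n N _ (fun k => |(Matrix.of (fun i j => lam j ^ k i)).det|) 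
      (fun k hk => (hdet k hk).symm)]
    exact Sg_nonneg _ _ _ (fun _ => abs_nonneg _)
  have hfin : ε * closedP n lam = |∏ i : Fin n, ∏ j : Fin n,
        if i < j then (lam j - lam i) / (1 - lam i * lam j) else 1| * ∏ i, (1 - lam i)⁻¹ := by
    rw [← abs_of_nonneg hpos, abs_mul, hε, one_mul, closedP, abs_mul]
    congr 1
    apply abs_of_nonneg
    exact Finset.prod_nonneg (fun i _ => inv_nonneg.2 (by linarith [(hlam i).2]))
  simp only [hS]
  rw [hfin] at hlim
  convert hlim.const_mul (2^n) using 2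
  simp only [div_eq_mul_inv, Finset.prod_mul_distrib]
  ring
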